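/- Let P and H be finite simple graphs, let S be a set of vertices of P, and let φ be a feasible minor embedding of the induced subgraph P[S] into H. Let v̄ be a vertex of P not in S whose set of P-neighbors lying in S is A, and suppose u is a vertex of H free with respect to φ, and for each v ∈ A there is a clean path Z_v in H from u to the chain φ(v), written Z_v = (u = z₀^v, z₁^v, …, z_{L_v}^v) with z_{L_v}^v ∈ φ(v) and all other vertices free, such that the paths {Z_v : v ∈ A} pairwise share no vertex other than u. For each v ∈ A choose an index 0 ≤ k_v < L_v, and define the extended map φ₊ on S ∪ {v̄} by: φ₊(v̄) = {u} ∪ ⋃_{v∈A} {z_i^v : 1 ≤ i ≤ k_v}, φ₊(v) = φ(v) ∪ {z_i^v : k_v + 1 ≤ i ≤ L_v} for v ∈ A, and φ₊(w) = φ(w) for all other w ∈ S. Then φ₊ is a feasible minor embedding of the induced subgraph P[S ∪ {v̄}] into H. (This is the content of Lemma 1: a successful node-embedding step extends a feasible embedding of P[S_{i−1}] to a feasible embedding of P[S_i].) -/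

import Mathlib

/-- `IsFeasibleEmbeddingOn P S H φ`: the restriction of `φ` to `S` is a feasible
minor embedding of the induced subgraph `P[S]` into `H`: every chain of a vertex
of `S` is nonempty, chains of distinct vertices of `S` are pairwise disjoint,
each such chain induces a connected subgraph of `H`, and every edge of `P[S]`
is realised by an edge of `H` between the two chains. -/
def IsFeasibleEmbeddingOn {V W : Type*} (P : SimpleGraph V) (S : Set V)
    (H : SimpleGraph W) (φ : V → Set W) : Prop :=
  (∀ v ∈ S, (φ v).Nonempty) ∧
  (∀ u ∈ S, ∀ v ∈ S, u ≠ v → Disjoint (φ u) (φ v)) ∧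
  (∀ v ∈ S, (H.induce (φ v)).Connected) ∧
  (∀ u ∈ S, ∀ v ∈ S, P.Adj u v → ∃ u' ∈ φ u, ∃ v' ∈ φ v, H.Adj u' v')

/-- `IsCleanPath H free chain u L z`: `z 0, z 1, …, z L` is a path in `H`
starting at `u`, whose last vertex lies in `chain` and all of whose other
vertices are free. -/
def IsCleanPath {W : Type*} (H : SimpleGraph W) (free : W → Prop) (chain : Set W)
    (u : W) (L : ℕ) (z : ℕ → W) : Prop :=
  z 0 = u ∧ (∀ i < L, H.Adj (z i) (z (i + 1))) ∧
  (Function.Injective fun i : Fin (L + 1) => z i.1) ∧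
  (∀ i < L, free (z i)) ∧ z L ∈ chain

/-- The endpoints of a segment of consecutively adjacent vertices inside `s` are joined in the
subgraph induced on `s`. -/
theorem reachable_induce_of_forall_adj {W : Type*} {H : SimpleGraph W} {s : Set W} {z : ℕ → W}
    {a b : ℕ} (hab : a ≤ b) (hmem : ∀ i, a ≤ i → i ≤ b → z i ∈ s)
    (hadj : ∀ i, a ≤ i → i < b → H.Adj (z i) (z (i + 1))) :
    (H.induce s).Reachable ⟨z a, hmem a le_rfl hab⟩ ⟨z b, hmem b hab le_rfl⟩ := by
  induction b, hab using Nat.le_induction with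
  | base => exact SimpleGraph.Reachable.refl _
  | succ b hab ih =>
    refine (ih (fun i h₁ h₂ => hmem i h₁ (by omega)) fun i h₁ h₂ => hadj i h₁ (by omega)).trans ?_
    exact SimpleGraph.Adj.reachable (SimpleGraph.induce_adj.2 (hadj b hab (by omega)))

/-- Lemma 1. A successful node-embedding step extends a
feasible embedding of `P[S]` to a feasible embedding of `P[S ∪ {v̄}]`. -/
theorem nodeEmbedding_extends_feasible {V W : Type*} [Fintype V] [Fintype W]
    (P : SimpleGraph V) (H : SimpleGraph W) (S : Set V) (φ : V → Set W)
    (hfeas : IsFeasibleEmbeddingOn P S H φ)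
    (vbar : V) (hvbar : vbar ∉ S)
    (A : Set V) (hAdef : A = {v | v ∈ S ∧ P.Adj vbar v})
    (u : W) (hufree : ∀ w ∈ S, u ∉ φ w)
    (L : V → ℕ) (z : V → ℕ → W)
    (hpath : ∀ v ∈ A,
      IsCleanPath H (fun q => ∀ w ∈ S, q ∉ φ w) (φ v) u (L v) (z v))
    (hshare : ∀ v ∈ A, ∀ v' ∈ A, v ≠ v' →
      ∀ i ≤ L v, ∀ j ≤ L v', z v i = z v' j → z v i = u)
    (k : V → ℕ) (hk : ∀ v ∈ A, k v < L v)
    (φplus : V → Set W)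
    (hplus_new : φplus vbar =
      {u} ∪ ⋃ v ∈ A, {q | ∃ i, 1 ≤ i ∧ i ≤ k v ∧ q = z v i})
    (hplus_A : ∀ v ∈ A,
      φplus v = φ v ∪ {q | ∃ i, k v + 1 ≤ i ∧ i ≤ L v ∧ q = z v i})
    (hplus_rest : ∀ w ∈ S, w ∉ A → φplus w = φ w) :
    IsFeasibleEmbeddingOn P (insert vbar S) H φplus := by
  obtain ⟨hne, hdisj, hconn, hedge⟩ := hfeas
  have hAS : ∀ v ∈ A, v ∈ S := fun v hv => (hAdef ▸ hv : v ∈ {v | v ∈ S ∧ P.Adj vbar v}).1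
  have hsub : ∀ v ∈ S, φ v ⊆ φplus v := by
    intro v hv
    by_cases hA : v ∈ A
    · rw [hplus_A v hA]
      exact Set.subset_union_left
    · rw [hplus_rest v hv hA]
  have hinj : ∀ v ∈ A, ∀ i ≤ L v, ∀ j ≤ L v, z v i = z v j → i = j := by
    intro v hv i hi j hj h
    have := @(hpath v hv).2.2.1 ⟨i, by omega⟩ ⟨j, by omega⟩ h
    simpa using this
  have hcross : ∀ v ∈ A, ∀ v' ∈ A, v ≠ v' → ∀ i, 1 ≤ i → i ≤ L v → ∀ j ≤ L v',
      z v i ≠ z v' j := by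
    intro v hv v' hv' hvv i hi hiL j hj h
    have hu := hshare v hv v' hv' hvv i hiL j hj h
    have := hinj v hv i hiL 0 (Nat.zero_le _) (hu.trans (hpath v hv).1.symm)
    omega
  have hmem_new : ∀ q, q ∈ φplus vbar ↔
      q = u ∨ ∃ v ∈ A, ∃ i, 1 ≤ i ∧ i ≤ k v ∧ q = z v i := by
    intro q
    simp [hplus_new]
  have hmem_old : ∀ v ∈ S, ∀ q, q ∈ φplus v ↔
      q ∈ φ v ∨ v ∈ A ∧ ∃ i, k v + 1 ≤ i ∧ i ≤ L v ∧ q = z v i := by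
    intro v hv q
    by_cases hA : v ∈ A
    · simp [hplus_A v hA, hA]
    · simp [hplus_rest v hv hA, hA]
  have hdisj_new : ∀ v ∈ S, Disjoint (φplus vbar) (φplus v) := by
    intro v hv
    refine Set.disjoint_left.2 fun q hq hq' => ?_
    rcases (hmem_new q).1 hq with rfl | ⟨a, ha, i, hi, hik, rfl⟩
    · rcases (hmem_old v hv q).1 hq' with h | ⟨hA, j, hj, hjL, h⟩
      · exact hufree v hv h
      · have := hinj v hA 0 (Nat.zero_le _) j hjL ((hpath v hA).1.trans h)
        omega
    · have hka := hk a ha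
      rcases (hmem_old v hv _).1 hq' with h | ⟨hA, j, hj, hjL, h⟩
      · exact (hpath a ha).2.2.2.1 i (by omega) v hv h
      · by_cases hav : a = v
        · subst hav
          have := hinj a ha i (by omega) j hjL h
          omega
        · exact hcross a ha v hA hav i hi (by omega) j hjL h
  have hpath_free : ∀ v ∈ A, ∀ w ∈ S, v ≠ w → ∀ i ≤ L v, z v i ∉ φ w := by
    intro v hv w hw hvw i hi h
    rcases hi.lt_or_eq with hlt | rfl
    · exact (hpath v hv).2.2.2.1 i hlt w hw h
    · exact Set.disjoint_left.1 (hdisj v (hAS v hv) w hw hvw) (hpath v hv).2.2.2.2 h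
  have hdisj_old : ∀ v ∈ S, ∀ w ∈ S, v ≠ w → Disjoint (φplus v) (φplus w) := by
    intro v hv w hw hvw
    refine Set.disjoint_left.2 fun q hq hq' => ?_
    rcases (hmem_old v hv q).1 hq with h | ⟨hA, i, hi, hiL, rfl⟩
    · rcases (hmem_old w hw q).1 hq' with h' | ⟨hA', j, hj, hjL, rfl⟩
      · exact Set.disjoint_left.1 (hdisj v hv w hw hvw) h h'
      · exact hpath_free w hA' v hv hvw.symm j hjL h
    · rcases (hmem_old w hw _).1 hq' with h' | ⟨hA', j, hj, hjL, h'⟩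
      · exact hpath_free v hA w hw hvw i hiL h'
      · exact hcross v hA w hA' hvw i (by omega) hiL j hjL h'
  have hpath_new : ∀ v ∈ A, ∀ i ≤ k v, z v i ∈ φplus vbar := by
    intro v hv i hi
    rw [hmem_new]
    rcases Nat.eq_zero_or_pos i with rfl | hpos
    · exact Or.inl (hpath v hv).1
    · exact Or.inr ⟨v, hv, i, hpos, hi, rfl⟩
  have hpath_old : ∀ v ∈ A, ∀ i, k v + 1 ≤ i → i ≤ L v → z v i ∈ φplus v := fun v hv i h₁ h₂ =>
    (hmem_old v (hAS v hv) _).2 (Or.inr ⟨hv, i, h₁, h₂, rfl⟩)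
  have hu_mem : u ∈ φplus vbar := (hmem_new u).2 (Or.inl rfl)
  have hconn_new : (H.induce (φplus vbar)).Connected := by
    rw [SimpleGraph.connected_iff_exists_forall_reachable]
    refine ⟨⟨u, hu_mem⟩, ?_⟩
    rintro ⟨q, hq⟩
    rcases (hmem_new q).1 hq with rfl | ⟨v, hv, i, hi, hik, rfl⟩
    · exact SimpleGraph.Reachable.refl _
    · have hkv := hk v hv
      have := reachable_induce_of_forall_adj (H := H) (s := φplus vbar) (z := z v) (Nat.zero_le i)
        (fun j _ hj => hpath_new v hv j (hj.trans hik))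
        fun j _ hj => (hpath v hv).2.1 j (by omega)
      simpa only [(hpath v hv).1] using this
  have hconn_old : ∀ v ∈ S, (H.induce (φplus v)).Connected := by
    intro v hv
    by_cases hA : v ∈ A
    · have hend := (hpath v hA).2.2.2.2
      rw [SimpleGraph.connected_iff_exists_forall_reachable]
      refine ⟨⟨z v (L v), hsub v hv hend⟩, ?_⟩
      rintro ⟨q, hq⟩
      rcases (hmem_old v hv q).1 hq with h | ⟨-, i, hi, hiL, rfl⟩
      · exact ((hconn v hv).preconnected ⟨_, hend⟩ ⟨q, h⟩).map
          (SimpleGraph.induceHomOfLE H (hsub v hv)).toHom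
      · exact (reachable_induce_of_forall_adj (H := H) (s := φplus v) (z := z v) hiL
          (fun j h₁ h₂ => hpath_old v hA j (hi.trans h₁) h₂)
          fun j _ hj => (hpath v hA).2.1 j hj).symm
    · rw [hplus_rest v hv hA]
      exact hconn v hv
  have hedge_new : ∀ v ∈ S, P.Adj vbar v →
      ∃ u' ∈ φplus vbar, ∃ v' ∈ φplus v, H.Adj u' v' := by
    intro v hv hadj
    have hA : v ∈ A := by
      rw [hAdef]
      exact ⟨hv, hadj⟩
    have hkv := hk v hA
    exact ⟨z v (k v), hpath_new v hA _ le_rfl, z v (k v + 1), hpath_old v hA _ le_rfl hkv,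
      (hpath v hA).2.1 _ hkv⟩
  refine ⟨?_, ?_, ?_, ?_⟩
  · rintro v (rfl | hv)
    · exact ⟨u, hu_mem⟩
    · exact (hne v hv).mono (hsub v hv)
  · rintro v (rfl | hv) w (rfl | hw) hvw
    · exact absurd rfl hvw
    · exact hdisj_new w hw
    · exact (hdisj_new v hv).symm
    · exact hdisj_old v hv w hw hvw
  · rintro v (rfl | hv)
    · exact hconn_new
    · exact hconn_old v hv
  · rintro v (rfl | hv) w (rfl | hw) hadj
    · exact absurd hadj (P.irrefl)
    · exact hedge_new w hw hadj
    · obtain ⟨a, ha, b, hb, hab⟩ := hedge_new v hv hadj.symm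
      exact ⟨b, hb, a, ha, hab.symm⟩
    · obtain ⟨a, ha, b, hb, hab⟩ := hedge v hv w hw hadj
      exact ⟨a, hsub v hv ha, b, hsub w hw hb, hab⟩
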